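/- In the corner construction: for each binary string s with 1 ≤ |s| ≤ k, let x_s = (1/2)·(y_{s·0^(k+1−|s|)} + y_{s·1^(k+1−|s|)}), where 0^m (resp. 1^m) denotes the string of m zeros (resp. m ones) appended to s. Then the points x_s are pairwise distinct, each x_s has integer coordinates of absolute value at most 2·5^(k+1), and the set X = { x_s : 1 ≤ |s| ≤ k } is a nested almost convex set with 2^(k+1) − 2 points. -/

import Mathlib

open Set

noncomputable section

/-- Points of the plane. -/
abbrev Pt : Type := ℝ × ℝ

/-- The orientation determinant of the triple `(a, b, c)`:
`c` lies strictly to the left of the directed line from `a` to `b` iff `orient a b c > 0`. -/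
def orient (a b c : Pt) : ℝ :=
  (b.1 - a.1) * (c.2 - a.2) - (b.2 - a.2) * (c.1 - a.1)

/-- A set of points is in general position if no three pairwise distinct points are collinear. -/
def GenPos (X : Set Pt) : Prop :=
  ∀ a ∈ X, ∀ b ∈ X, ∀ c ∈ X, a ≠ b → a ≠ c → b ≠ c → orient a b c ≠ 0

/-- The set of extreme points of the convex hull of `S`. -/
def extremePts (S : Set Pt) : Set Pt := Set.extremePoints ℝ (convexHull ℝ S)

/-- Remove the extreme points of the convex hull (one peeling step of convex layers). -/
def peel (S : Set Pt) : Set Pt := S \ extremePts S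

/-- `X` has exactly `k` convex layers. -/
def HasLayers (X : Set Pt) (k : ℕ) : Prop :=
  peel^[k] X = ∅ ∧ ∀ j < k, peel^[j] X ≠ ∅

/-- `X_j`, the union of the `j` innermost convex layers (when `X` has `k` layers). -/
def layerSub (X : Set Pt) (k j : ℕ) : Set Pt := peel^[k - j] X

/-- `R_j`, the `j`-th convex layer of `X` (when `X` has `k` layers), `R_1` innermost. -/
def layer (X : Set Pt) (k j : ℕ) : Set Pt := extremePts (layerSub X k j)

/-- `X` is a nested almost convex set. -/
def IsNACS (X : Set Pt) : Prop :=
  X.Finite ∧ X.Nonempty ∧ GenPos X ∧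
  ∀ k, HasLayers X k →
    ∀ j, 1 ≤ j → j ≤ k →
      ∀ a ∈ layer X k j, ∀ b ∈ layer X k j, ∀ c ∈ layer X k j,
        a ≠ b → a ≠ c → b ≠ c →
        ∃! p : Pt, p ∈ layerSub X k (j - 1) ∩ interior (convexHull ℝ ({a, b, c} : Set Pt))

/-- `q` is a counterclockwise enumeration of `S`. -/
def CCWEnum {m : ℕ} (S : Set Pt) (q : Fin m → Pt) : Prop :=
  Function.Injective q ∧ Set.range q = S ∧
  ∀ a b c : Fin m, a < b → b < c → 0 < orient (q a) (q b) (q c)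

/-- The ordered pair `(q1, q2)` of points of `R` is adoptable from `p`. -/
def AdoptablePair (R : Set Pt) (p q1 q2 : Pt) : Prop :=
  ∀ q3 ∈ R \ ({q1, q2} : Set Pt), p ∈ interior (convexHull ℝ ({q1, q2, q3} : Set Pt))

/-- The `i`-th binary string of length `j` in lexicographic order (`false` before `true`). -/
def strOfNat (j i : ℕ) : List Bool :=
  (List.range j).map fun t => i.testBit (j - 1 - t)

/-- The numeric (lexicographic) rank of a binary string among strings of its length. -/
def natOfStr (s : List Bool) : ℕ := s.foldl (fun n b => 2 * n + b.toNat) 0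

/-- The leftmost `k`-level descendant of the node `s`. -/
def firstStr (k : ℕ) (s : List Bool) : List Bool := s ++ List.replicate (k - s.length) false

/-- The rightmost `k`-level descendant of the node `s`. -/
def lastStr (k : ℕ) (s : List Bool) : List Bool := s ++ List.replicate (k - s.length) true

/-- Non-root nodes of the tree `T₁(k)`: binary strings of length `1..k`. -/
def ValidNode1 (k : ℕ) (s : List Bool) : Prop := 1 ≤ s.length ∧ s.length ≤ k

/-- A type-1 labeling of `X`, given by its label function `x` (the inverse of `ψ`). -/
def IsLabeling1 (k : ℕ) (X : Set Pt) (x : List Bool → Pt) : Prop :=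
  Set.InjOn x {s | ValidNode1 k s} ∧ x '' {s | ValidNode1 k s} = X

/-- A type-1 labeling is nested. -/
def Nested1 (k : ℕ) (X : Set Pt) (x : List Bool → Pt) : Prop :=
  ∀ j, 1 ≤ j → j ≤ k →
    CCWEnum (layer X k j) fun i : Fin (2 ^ j) => x (strOfNat j i.val)

/-- A type-1 labeling is adoptable. -/
def Adoptable1 (k : ℕ) (X : Set Pt) (x : List Bool → Pt) : Prop :=
  ∀ s : List Bool, 1 ≤ s.length → s.length + 1 ≤ k →
    AdoptablePair (layer X k (s.length + 1)) (x s) (x (s ++ [false])) (x (s ++ [true]))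

/-- `previous[R_k(u)]` for a type-1 labeling: the cyclic predecessor (in the left-to-right,
i.e. counterclockwise, order of the `k`-level) of `first[R_k(u)]`. -/
def prev1 (k : ℕ) (x : List Bool → Pt) (s : List Bool) : Pt :=
  x (strOfNat k ((natOfStr (firstStr k s) + (2 ^ k - 1)) % 2 ^ k))

/-- `next[R_k(u)]` for a type-1 labeling: the cyclic successor of `last[R_k(u)]`. -/
def next1 (k : ℕ) (x : List Bool → Pt) (s : List Bool) : Pt :=
  x (strOfNat k ((natOfStr (lastStr k s) + 1) % 2 ^ k))

/-- A type-1 labeling is well laid. -/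
def WellLaid1 (k : ℕ) (x : List Bool → Pt) : Prop :=
  ∀ s : List Bool, 1 ≤ s.length → s.length ≤ k →
    x s ∈ convexHull ℝ ({prev1 k x s, x (firstStr k s), x (lastStr k s)} : Set Pt) ∧
    x s ∈ convexHull ℝ ({x (firstStr k s), x (lastStr k s), next1 k x s} : Set Pt)

/-- `X_u` for a type-1 labeling: the labels of the proper descendants of `s`. -/
def descSet1 (k : ℕ) (x : List Bool → Pt) (s : List Bool) : Set Pt :=
  x '' {t | ValidNode1 k t ∧ s <+: t ∧ s ≠ t}

/-- `X̄_u = X_u ∪ {x_u}` for a type-1 labeling. -/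
def barSet1 (k : ℕ) (x : List Bool → Pt) (s : List Bool) : Set Pt :=
  insert (x s) (descSet1 k x s)

/-- A type-1 labeling is an internal separation. -/
def InternalSep1 (k : ℕ) (X : Set Pt) (x : List Bool → Pt) : Prop :=
  ∀ s : List Bool, s.length + 1 ≤ k →
    ∀ y ∈ X \ descSet1 k x s,
      ∀ a ∈ barSet1 k x (s ++ [false]), ∀ b ∈ barSet1 k x (s ++ [true]),
        0 < orient a b y

/-- A type-1 labeling is an external separation. -/
def ExternalSep1 (k : ℕ) (X : Set Pt) (x : List Bool → Pt) : Prop :=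
  ∀ s : List Bool, 1 ≤ s.length → s.length + 1 ≤ k →
    ∀ y ∈ X \ barSet1 k x s,
      (∀ a ∈ barSet1 k x (s ++ [false]), 0 < orient a (x s) y) ∧
      (∀ b ∈ barSet1 k x (s ++ [true]), 0 < orient (x s) b y)

/-- Nodes of the tree `T₂(k)`: the root `none`, and pairs `(c, s)`. -/
abbrev Node2 : Type := Option (Fin 3 × List Bool)

/-- Valid nodes of `T₂(k)`: the root, and pairs `(c, s)` with `|s| ≤ k - 2`. -/
def ValidNode2 (k : ℕ) : Node2 → Prop
  | none => True
  | some (_, s) => s.length + 2 ≤ k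

/-- A type-2 labeling of `X`, given by its label function `x` (the inverse of `ψ`). -/
def IsLabeling2 (k : ℕ) (X : Set Pt) (x : Node2 → Pt) : Prop :=
  Set.InjOn x {u | ValidNode2 k u} ∧ x '' {u | ValidNode2 k u} = X

/-- The `i`-th node (left-to-right) of the `(j+2)`-level of `T₂(k)`. -/
def node2At (j i : ℕ) : Node2 :=
  some (⟨i / 2 ^ j % 3, by omega⟩, strOfNat j (i % 2 ^ j))

/-- A type-2 labeling is nested. -/
def Nested2 (k : ℕ) (X : Set Pt) (x : Node2 → Pt) : Prop :=
  CCWEnum (layer X k 1) (fun _ : Fin 1 => x none) ∧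
  ∀ j : ℕ, j + 2 ≤ k →
    CCWEnum (layer X k (j + 2)) fun i : Fin (3 * 2 ^ j) => x (node2At j i.val)

/-- A type-2 labeling is adoptable. -/
def Adoptable2 (k : ℕ) (X : Set Pt) (x : Node2 → Pt) : Prop :=
  ∀ (c : Fin 3) (s : List Bool), s.length + 3 ≤ k →
    AdoptablePair (layer X k (s.length + 3)) (x (some (c, s)))
      (x (some (c, s ++ [false]))) (x (some (c, s ++ [true])))

/-- `previous[R_k(u)]` for a type-2 labeling, `u = (c, s)`. -/
def prev2 (k : ℕ) (x : Node2 → Pt) (c : Fin 3) (s : List Bool) : Pt :=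
  x (node2At (k - 2)
      ((c.val * 2 ^ (k - 2) + natOfStr (firstStr (k - 2) s) + (3 * 2 ^ (k - 2) - 1)) %
        (3 * 2 ^ (k - 2))))

/-- `next[R_k(u)]` for a type-2 labeling, `u = (c, s)`. -/
def next2 (k : ℕ) (x : Node2 → Pt) (c : Fin 3) (s : List Bool) : Pt :=
  x (node2At (k - 2)
      ((c.val * 2 ^ (k - 2) + natOfStr (lastStr (k - 2) s) + 1) % (3 * 2 ^ (k - 2))))

/-- A type-2 labeling is well laid (the root is the only node with `R_k(u) = R_k`). -/
def WellLaid2 (k : ℕ) (x : Node2 → Pt) : Prop :=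
  ∀ (c : Fin 3) (s : List Bool), s.length + 2 ≤ k →
    x (some (c, s)) ∈ convexHull ℝ
      ({prev2 k x c s, x (some (c, firstStr (k - 2) s)),
        x (some (c, lastStr (k - 2) s))} : Set Pt) ∧
    x (some (c, s)) ∈ convexHull ℝ
      ({x (some (c, firstStr (k - 2) s)), x (some (c, lastStr (k - 2) s)),
        next2 k x c s} : Set Pt)

/-- `X_u` for a type-2 labeling and a non-root node `u = (c, s)`. -/
def descSet2 (k : ℕ) (x : Node2 → Pt) (c : Fin 3) (s : List Bool) : Set Pt :=
  x '' {u | ∃ t : List Bool, u = some (c, t) ∧ t.length + 2 ≤ k ∧ s <+: t ∧ s ≠ t}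

/-- `X̄_u = X_u ∪ {x_u}` for a type-2 labeling and a non-root node `u = (c, s)`. -/
def barSet2 (k : ℕ) (x : Node2 → Pt) (c : Fin 3) (s : List Bool) : Set Pt :=
  insert (x (some (c, s))) (descSet2 k x c s)

/-- A type-2 labeling is an internal separation. -/
def InternalSep2 (k : ℕ) (X : Set Pt) (x : Node2 → Pt) : Prop :=
  (∀ (c : Fin 3) (s : List Bool), s.length + 3 ≤ k →
    ∀ y ∈ X \ descSet2 k x c s,
      ∀ a ∈ barSet2 k x c (s ++ [false]), ∀ b ∈ barSet2 k x c (s ++ [true]),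
        0 < orient a b y) ∧
  (∀ i : Fin 3,
    ∀ y ∈ X \ (barSet2 k x i [] ∪ barSet2 k x (i + 1) []),
      ∀ a ∈ barSet2 k x i [], ∀ b ∈ barSet2 k x (i + 1) [],
        0 < orient a b y)

/-- A type-2 labeling is an external separation. -/
def ExternalSep2 (k : ℕ) (X : Set Pt) (x : Node2 → Pt) : Prop :=
  ∀ (c : Fin 3) (s : List Bool), s.length + 3 ≤ k →
    ∀ y ∈ X \ barSet2 k x c s,
      (∀ a ∈ barSet2 k x c (s ++ [false]), 0 < orient a (x (some (c, s))) y) ∧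
      (∀ b ∈ barSet2 k x c (s ++ [true]), 0 < orient (x (some (c, s))) b y)

/-- One corner-refinement step: from `α_s = (q, o, p)` to `α_{s0}` (for `b = false`)
or `α_{s1}` (for `b = true`). -/
def cornerStep (α : Pt × Pt × Pt) (b : Bool) : Pt × Pt × Pt :=
  let q := α.1
  let o := α.2.1
  let p := α.2.2
  if b then (o + (1 / 5 : ℝ) • (q - o), o + (1 / 5 : ℝ) • (p - o), o + (2 / 5 : ℝ) • (p - o))
  else (o + (2 / 5 : ℝ) • (q - o), o + (1 / 5 : ℝ) • (q - o), o + (1 / 5 : ℝ) • (p - o))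

/-- The corner `α_s = (q_s, o_s, p_s)` assigned to the binary string `s` (with parameter `k`). -/
def corner (k : ℕ) (s : List Bool) : Pt × Pt × Pt :=
  s.foldl cornerStep
    (((0 : ℝ), (2 * 5 ^ (k + 1) : ℝ)), ((0 : ℝ), (0 : ℝ)), ((2 * 5 ^ (k + 1) : ℝ), (0 : ℝ)))

/-- The point `y_v` for a binary string `v = s ++ [b]` of positive length. -/
def ypt (k : ℕ) (v : List Bool) : Pt :=
  let α := corner k v.dropLast
  if v.getLastD false then α.2.1 + (1 / 5 : ℝ) • (α.2.2 - α.2.1)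
  else α.2.1 + (1 / 5 : ℝ) • (α.1 - α.2.1)

/-- The point `x_s`: the midpoint of `y_{s·0^(k+1−|s|)}` and `y_{s·1^(k+1−|s|)}`. -/
def xpt (k : ℕ) (s : List Bool) : Pt :=
  (1 / 2 : ℝ) •
    (ypt k (s ++ List.replicate (k + 1 - s.length) false) +
      ypt k (s ++ List.replicate (k + 1 - s.length) true))

/-- scale constants -/
def cc : ℕ → ℝ
  | 0 => 0
  | n + 1 => (1 + 2 * cc n) / 10

/-- local affine maps -/
def AA (b : Bool) (P : Pt) : Pt :=
  if b then ((1 - P.2 + P.1) / 5, P.2 / 5) else (P.1 / 5, (1 + P.2 - P.1) / 5)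

/-- inverse maps -/
def BB (b : Bool) (P : Pt) : Pt :=
  if b then (5 * P.1 + 5 * P.2 - 1, 5 * P.2) else (5 * P.1, 5 * P.1 + 5 * P.2 - 1)

/-- normalized points -/
def zz : ℕ → List Bool → Pt
  | n, [] => (cc n, cc n)
  | 0, _ :: _ => (0, 0)
  | n + 1, b :: s => AA b (zz n s)

/-- inorder comparison -/
def ilt : List Bool → List Bool → Bool
  | [], [] => false
  | [], b :: _ => b
  | b :: _, [] => !b
  | b :: s, c :: t => if b = c then ilt s t else c

/-- combinatorial orientation sign -/
def sg : List Bool → List Bool → List Bool → Bool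
  | [], t, r => ilt t r
  | s, [], r => ilt r s
  | s, t, [] => ilt s t
  | x :: s, y :: t, z :: r =>
    if x = y then (if y = z then sg s t r else ilt s t)
    else if y = z then ilt t r else ilt r s

lemma cc_le (n : ℕ) : 0 ≤ cc n ∧ cc n < 1 / 8 := by
  induction n with
  | zero => simp [cc]
  | succ n ih => simp only [cc]; constructor <;> linarith [ih.1, ih.2]

lemma cc_pos (n : ℕ) : 1 / 10 ≤ cc (n + 1) := by
  simp only [cc]; linarith [(cc_le n).1]

lemma cc_two (n : ℕ) : 3 / 25 ≤ cc (n + 2) := by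
  rw [cc]; linarith [cc_pos n]

lemma zz_T (s : List Bool) : ∀ n, s.length < n →
    0 ≤ (zz n s).1 ∧ 0 ≤ (zz n s).2 ∧ 1 / 5 ≤ (zz n s).1 + (zz n s).2 ∧
    (zz n s).1 + (zz n s).2 ≤ 2 * cc n ∧ (zz n s).1 < 2 * cc n ∧ (zz n s).2 < 2 * cc n := by
  induction s with
  | nil =>
    intro n hn
    obtain ⟨m, rfl⟩ : ∃ m, n = m + 1 := ⟨n - 1, by simp at hn; omega⟩
    have := cc_pos m
    simp only [zz]
    refine ⟨?_, ?_, ?_, ?_, ?_, ?_⟩ <;> linarith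
  | cons b s ih =>
    intro n hn
    obtain ⟨m, rfl⟩ : ∃ m, n = m + 1 := ⟨n - 1, by simp at hn; omega⟩
    obtain ⟨h1, h2, h3, h4, h5, h6⟩ := ih m (by simpa using hn)
    have := cc_le m
    cases b <;> simp only [zz, AA, cc] <;> simp only [Bool.false_eq_true, if_false, if_true] <;>
      refine ⟨?_, ?_, ?_, ?_, ?_, ?_⟩ <;> linarith

/-- outer region -/
def OO (P : Pt) : Prop := 0 ≤ P.1 ∧ 0 ≤ P.2 ∧ 3 / 4 ≤ P.1 + P.2

lemma OO_BB (b : Bool) (P : Pt) (h : OO P) : OO (BB b P) := by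
  obtain ⟨h1, h2, h3⟩ := h
  cases b <;> simp only [BB, OO] <;> simp only [Bool.false_eq_true, if_false, if_true] <;>
    refine ⟨?_, ?_, ?_⟩ <;> linarith

lemma OO_root (b : Bool) (n : ℕ) : OO (BB b (zz (n + 2) [])) := by
  have := cc_two n
  cases b <;> simp only [BB, OO, zz] <;> simp only [Bool.false_eq_true, if_false, if_true] <;>
    refine ⟨?_, ?_, ?_⟩ <;> linarith

lemma OO_diff (b c : Bool) (hbc : b ≠ c) (n : ℕ) (s : List Bool) (hs : s.length < n) :
    OO (BB b (zz (n + 1) (c :: s))) := by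
  obtain ⟨h1, h2, h3, h4, h5, h6⟩ := zz_T s n hs
  have := cc_le n
  cases b <;> cases c <;> simp only [ne_eq, not_true_eq_false, reduceCtorEq] at hbc <;>
    simp only [BB, OO, zz, AA] <;> simp only [Bool.false_eq_true, if_false, if_true] <;>
    refine ⟨?_, ?_, ?_⟩ <;> linarith

lemma orient_AA (b : Bool) (p q r : Pt) :
    orient (AA b p) (AA b q) r = (1 / 25) * orient p q (BB b r) := by
  cases b <;> simp only [AA, BB, orient] <;> simp only [Bool.false_eq_true, if_false, if_true] <;> ring

lemma orient_cyc (p q r : Pt) : orient p q r = orient q r p := by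
  simp only [orient]; ring

lemma orient_anti (p q r : Pt) : orient q p r = - orient p q r := by
  simp only [orient]; ring

lemma BB_AA (b : Bool) (p : Pt) : BB b (AA b p) = p := by
  cases b <;> simp only [AA, BB] <;> ext <;> simp <;> ring

/-- linear functionals on the outer region -/
lemma lin_OO (α β γ : ℝ) (P : Pt) (h : OO P) (hα : γ < α * (3 / 4)) (hβ : γ < β * (3 / 4))
    (hα0 : 0 ≤ α) (hβ0 : 0 ≤ β) : γ < α * P.1 + β * P.2 := by
  obtain ⟨h1, h2, h3⟩ := h
  rcases le_total α β with hab | hab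
  · have : 0 ≤ (β - α) * P.2 := mul_nonneg (by linarith) h2
    have : 0 ≤ α * (P.1 + P.2 - 3/4) := mul_nonneg hα0 (by linarith)
    nlinarith
  · have : 0 ≤ (α - β) * P.1 := mul_nonneg (by linarith) h1
    have : 0 ≤ β * (P.1 + P.2 - 3/4) := mul_nonneg hβ0 (by linarith)
    nlinarith

lemma ext_left (a : Pt) (c : ℝ) (P : Pt) (hP : OO P) (h1 : 0 ≤ a.1) (h2 : a.1 ≤ 1 / 20)
    (h3 : 1 / 5 ≤ a.1 + a.2) (h4 : a.2 ≤ 1 / 4) (hc : 3 / 25 ≤ c) (hc' : c ≤ 1 / 8) :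
    0 < orient a (c, c) P := by
  have key := lin_OO (a.2 - c) (c - a.1) ((c - a.1) * a.2 + (a.2 - c) * a.1) P hP
    (by nlinarith [mul_nonneg h1 (by linarith : (0:ℝ) ≤ 1/8 - c), mul_nonneg (by linarith : (0:ℝ) ≤ a.1 + a.2 - 1/5) (by linarith : (0:ℝ) ≤ 1/8 - c)])
    (by nlinarith [mul_nonneg h1 (by linarith : (0:ℝ) ≤ 1/8 - c), mul_nonneg (by linarith : (0:ℝ) ≤ 1/4-a.2) (by linarith : (0:ℝ) ≤ c-3/25)]) (by linarith) (by linarith)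
  simp only [orient]
  nlinarith

lemma ext_right (b : Pt) (c : ℝ) (P : Pt) (hP : OO P) (h1 : 0 ≤ b.2) (h2 : b.2 ≤ 1 / 20)
    (h3 : 1 / 5 ≤ b.1 + b.2) (h4 : b.1 ≤ 1 / 4) (hc : 3 / 25 ≤ c) (hc' : c ≤ 1 / 8) :
    0 < orient (c, c) b P := by
  have := ext_left (b.2, b.1) c (P.2, P.1) ⟨hP.2.1, hP.1, by linarith [hP.2.2]⟩ h1 h2
    (by simp only; linarith) h4 hc hc'
  simp only [orient] at this ⊢
  nlinarith

lemma int_far (a b : Pt) (P : Pt) (hP : OO P) (h1 : 0 ≤ a.1) (h2 : a.1 ≤ 1 / 20)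
    (h3 : 1 / 5 ≤ a.1 + a.2) (h4 : a.2 ≤ 1 / 4) (g1 : 0 ≤ b.2) (g2 : b.2 ≤ 1 / 20)
    (g3 : 1 / 5 ≤ b.1 + b.2) (g4 : b.1 ≤ 1 / 4) :
    0 < orient a b P := by
  have key := lin_OO (a.2 - b.2) (b.1 - a.1) ((b.1 - a.1) * a.2 + (a.2 - b.2) * a.1) P hP
    (by nlinarith [mul_nonneg h1 g1, mul_nonneg (by linarith : (0:ℝ) ≤ 1/4-a.2) (by linarith : (0:ℝ) ≤ 1/4 - b.1)])
    (by nlinarith [mul_nonneg h1 g1, mul_nonneg (by linarith : (0:ℝ) ≤ 1/4-a.2) (by linarith : (0:ℝ) ≤ 1/4 - b.1)]) (by linarith) (by linarith)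
  simp only [orient]
  nlinarith

lemma int_near (a b : Pt) (c : ℝ) (h2 : a.1 < c) (h3 : a.1 + a.2 < 2 * c)
    (g2 : c < b.1) (g3 : b.1 + b.2 < 2 * c) :
    0 < orient a b (c, c) := by
  simp only [orient]
  nlinarith [mul_pos (sub_pos.2 h3) (sub_pos.2 g2), mul_pos (sub_pos.2 g3) (sub_pos.2 h2)]

lemma zz_false (n : ℕ) (s : List Bool) (hs : s.length < n) :
    0 ≤ (zz (n + 1) (false :: s)).1 ∧ (zz (n + 1) (false :: s)).1 ≤ 1 / 20 ∧
    1 / 5 ≤ (zz (n + 1) (false :: s)).1 + (zz (n + 1) (false :: s)).2 ∧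
    (zz (n + 1) (false :: s)).2 ≤ 1 / 4 ∧
    (zz (n + 1) (false :: s)).1 + (zz (n + 1) (false :: s)).2 < 2 * cc (n + 1) := by
  obtain ⟨h1, h2, h3, h4, h5, h6⟩ := zz_T s n hs
  have := cc_le n
  simp only [zz, AA, cc]
  simp only [Bool.false_eq_true, if_false]
  refine ⟨?_, ?_, ?_, ?_, ?_⟩ <;> linarith

lemma zz_true (n : ℕ) (s : List Bool) (hs : s.length < n) :
    0 ≤ (zz (n + 1) (true :: s)).2 ∧ (zz (n + 1) (true :: s)).2 ≤ 1 / 20 ∧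
    1 / 5 ≤ (zz (n + 1) (true :: s)).1 + (zz (n + 1) (true :: s)).2 ∧
    (zz (n + 1) (true :: s)).1 ≤ 1 / 4 ∧
    (zz (n + 1) (true :: s)).1 + (zz (n + 1) (true :: s)).2 < 2 * cc (n + 1) := by
  obtain ⟨h1, h2, h3, h4, h5, h6⟩ := zz_T s n hs
  have := cc_le n
  simp only [zz, AA, cc]
  simp only [if_true]
  refine ⟨?_, ?_, ?_, ?_, ?_⟩ <;> linarith

lemma two_le_of_cons {n : ℕ} {b : Bool} {s : List Bool} (h : (b :: s).length < n) :
    ∃ m, n = m + 2 ∧ s.length < m + 1 := by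
  simp only [List.length_cons] at h
  exact ⟨n - 2, by omega, by omega⟩

lemma orient_far (s : List Bool) : ∀ (t : List Bool) (n : ℕ) (P : Pt), s.length < n →
    t.length < n → OO P → ilt s t = true → 0 < orient (zz n s) (zz n t) P := by
  induction s with
  | nil =>
    intro t n P hs ht hP h
    cases t with
    | nil => simp [ilt] at h
    | cons b t =>
      obtain ⟨m, rfl, hm⟩ := two_le_of_cons ht
      simp only [ilt] at h
      subst h
      obtain ⟨h1, h2, h3, h4, h5⟩ := zz_true (m + 1) t hm
      have := cc_le (m + 2)
      exact ext_right _ _ P hP h1 h2 h3 h4 (cc_two m) this.2.le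
  | cons a s ih =>
    intro t n P hs ht hP h
    obtain ⟨m, rfl, hm⟩ := two_le_of_cons hs
    cases t with
    | nil =>
      simp only [ilt, Bool.not_eq_true'] at h
      subst h
      obtain ⟨h1, h2, h3, h4, h5⟩ := zz_false (m + 1) s hm
      have := cc_le (m + 2)
      exact ext_left _ _ P hP h1 h2 h3 h4 (cc_two m) this.2.le
    | cons b t =>
      have ht' : t.length < m + 1 := by simpa using ht
      by_cases hab : a = b
      · subst hab
        simp only [ilt, if_true] at h
        simp only [zz, orient_AA]
        have := ih t (m + 1) _ hm ht' (OO_BB a P hP) h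
        linarith
      · simp only [ilt, if_neg hab] at h
        subst h
        have : a = false := by simpa using hab
        subst this
        obtain ⟨h1, h2, h3, h4, h5⟩ := zz_false (m + 1) s hm
        obtain ⟨g1, g2, g3, g4, g5⟩ := zz_true (m + 1) t ht'
        exact int_far _ _ P hP h1 h2 h3 h4 g1 g2 g3 g4

lemma orient_root (s t : List Bool) (n : ℕ) (hs : s.length < n) (ht : t.length < n)
    (hs0 : s ≠ []) (ht0 : t ≠ []) (h : ilt s t = true) :
    0 < orient (zz n s) (zz n t) (zz n []) := by
  cases s with
  | nil => simp at hs0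
  | cons a s =>
    cases t with
    | nil => simp at ht0
    | cons b t =>
      obtain ⟨m, rfl, hm⟩ := two_le_of_cons hs
      have ht' : t.length < m + 1 := by simpa using ht
      by_cases hab : a = b
      · subst hab
        simp only [ilt, if_true] at h
        have := orient_far s t (m + 1) _ hm ht' (OO_root a m) h
        rw [show zz (m + 2) (a :: s) = AA a (zz (m + 1) s) from rfl,
          show zz (m + 2) (a :: t) = AA a (zz (m + 1) t) from rfl, orient_AA]
        linarith
      · simp only [ilt, if_neg hab] at h
        subst h
        have : a = false := by simpa using hab
        subst this
        obtain ⟨h1, h2, h3, h4, h5⟩ := zz_false (m + 1) s hm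
        obtain ⟨g1, g2, g3, g4, g5⟩ := zz_true (m + 1) t ht'
        have c1 := cc_two m
        have c2 := cc_le (m + 2)
        refine int_near _ _ _ (by linarith) h5 (by linarith) g5

lemma orient_diff (b c : Bool) (hbc : b ≠ c) (s t r : List Bool) (n : ℕ) (hs : s.length < n)
    (ht : t.length < n) (hr : r.length < n) (h : ilt s t = true) :
    0 < orient (zz (n + 1) (b :: s)) (zz (n + 1) (b :: t)) (zz (n + 1) (c :: r)) := by
  have := orient_far s t n _ hs ht (OO_diff b c hbc n r hr) h
  rw [show zz (n + 1) (b :: s) = AA b (zz n s) from rfl,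
    show zz (n + 1) (b :: t) = AA b (zz n t) from rfl, orient_AA]
  linarith

lemma orient_sg (s : List Bool) : ∀ (t r : List Bool) (n : ℕ), s.length < n → t.length < n →
    r.length < n → s ≠ t → s ≠ r → t ≠ r → sg s t r = true →
    0 < orient (zz n s) (zz n t) (zz n r) := by
  induction s with
  | nil =>
    intro t r n hs ht hr h1 h2 h3 h
    rw [orient_cyc]
    exact orient_root t r n ht hr h1.symm h2.symm (by simpa [sg] using h)
  | cons x s ih =>
    intro t r n hs ht hr h1 h2 h3 h
    rcases t with _ | ⟨y, t⟩
    · rw [← orient_cyc]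
      exact orient_root r (x :: s) n hr hs h3.symm (by simp) (by simpa [sg] using h)
    · rcases r with _ | ⟨z, r⟩
      · exact orient_root _ _ n hs ht (by simp) (by simp) (by simpa [sg] using h)
      · obtain ⟨m, rfl, hm⟩ := two_le_of_cons hs
        have ht' : t.length < m + 1 := by simpa using ht
        have hr' : r.length < m + 1 := by simpa using hr
        simp only [sg] at h
        by_cases hxy : x = y
        · subst hxy
          by_cases hxz : x = z
          · subst hxz
            simp only [if_true] at h
            simp only [zz, orient_AA, BB_AA]
            have := ih t r (m + 1) hm ht' hr' (by simpa using h1) (by simpa using h2)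
              (by simpa using h3) h
            linarith
          · simp only [if_true, if_neg hxz] at h
            exact orient_diff x z hxz s t r _ hm ht' hr' h
        · by_cases hyz : y = z
          · subst hyz
            simp only [if_true, if_neg hxy] at h
            rw [orient_cyc]
            exact orient_diff y x (Ne.symm hxy) t r s _ ht' hr' hm h
          · simp only [if_neg hyz, if_neg hxy] at h
            have : x = z := by cases x <;> cases y <;> cases z <;> simp_all
            subst this
            rw [← orient_cyc]
            exact orient_diff x y hxy r s t _ hr' hm ht' h

lemma ilt_total (s : List Bool) : ∀ t, s ≠ t → ilt t s = !ilt s t := by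
  induction s with
  | nil => intro t h; cases t <;> simp_all [ilt]
  | cons a s ih =>
    intro t h
    cases t with
    | nil => simp [ilt]
    | cons b t =>
      by_cases hab : a = b
      · subst hab; simp only [ilt, if_true]; exact ih t (by simpa using h)
      · simp only [ilt, if_neg hab, if_neg (Ne.symm hab)]
        cases a <;> cases b <;> simp_all

lemma ilt_trans (s : List Bool) : ∀ t r, ilt s t = true → ilt t r = true → ilt s r = true := by
  induction s with
  | nil =>
    intro t r
    cases t with
    | nil => simp [ilt]
    | cons b t =>
      cases r with
      | nil => cases b <;> simp [ilt]
      | cons c r => cases b <;> cases c <;> simp [ilt]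
  | cons a s ih =>
    intro t r
    cases t with
    | nil =>
      cases r with
      | nil => simp [ilt]
      | cons c r => cases a <;> cases c <;> simp [ilt]
    | cons b t =>
      cases r with
      | nil => cases a <;> cases b <;> simp [ilt]
      | cons c r => 
        have := ih t r
        cases a <;> cases b <;> cases c <;> simp_all [ilt]

lemma ilt_irrefl (s : List Bool) : ilt s s = false := by
  induction s with
  | nil => rfl
  | cons a s ih => simpa [ilt] using ih

lemma sg_cyc (s : List Bool) : ∀ t r, s ≠ t → s ≠ r → t ≠ r → sg s t r = sg t r s := by
  induction s with
  | nil => intro t r; cases t <;> cases r <;> simp [sg]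
  | cons x s ih =>
    intro t r h1 h2 h3
    cases t with
    | nil => cases r <;> simp_all [sg]
    | cons y t =>
      cases r with
      | nil => simp [sg]
      | cons z r =>
        have := ih t r
        cases x <;> cases y <;> cases z <;> simp_all [sg]

lemma sg_anti (s : List Bool) : ∀ t r, s ≠ t → s ≠ r → t ≠ r → sg t s r = !sg s t r := by
  induction s with
  | nil =>
    intro t r h1 h2 h3
    cases t with
    | nil => simp at h1
    | cons y t =>
      have := ilt_total (y :: t) r h3
      cases r <;> simp_all [sg]
  | cons x s ih =>
    intro t r h1 h2 h3
    cases t with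
    | nil =>
      have := ilt_total (x :: s) r h2
      cases r <;> simp_all [sg]
    | cons y t =>
      cases r with
      | nil => simpa [sg] using ilt_total _ _ h1
      | cons z r =>
        have := ih t r
        have a1 := ilt_total s t
        have a2 := ilt_total s r
        have a3 := ilt_total t r
        cases x <;> cases y <;> cases z <;> simp_all [sg]

lemma orient_sg_neg (s t r : List Bool) (n : ℕ) (hs : s.length < n) (ht : t.length < n)
    (hr : r.length < n) (h1 : s ≠ t) (h2 : s ≠ r) (h3 : t ≠ r) (h : sg s t r = false) :
    orient (zz n s) (zz n t) (zz n r) < 0 := by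
  have := orient_sg t s r n ht hs hr h1.symm h3 h2 (by rw [sg_anti s t r h1 h2 h3, h]; rfl)
  rw [orient_anti] at this
  linarith

lemma orient_sg_iff (s t r : List Bool) (n : ℕ) (hs : s.length < n) (ht : t.length < n)
    (hr : r.length < n) (h1 : s ≠ t) (h2 : s ≠ r) (h3 : t ≠ r) :
    0 < orient (zz n s) (zz n t) (zz n r) ↔ sg s t r = true := by
  constructor
  · intro h
    by_contra h'
    have := orient_sg_neg s t r n hs ht hr h1 h2 h3 (by simpa using h')
    linarith
  · exact orient_sg s t r n hs ht hr h1 h2 h3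

lemma zz_inj (s t : List Bool) (n : ℕ) (hs : s.length < n) (ht : t.length < n) (h : s ≠ t) :
    zz n s ≠ zz n t := by
  intro he
  have hO : OO ((1, 0) : Pt) := by simp only [OO]; norm_num
  by_cases hl : ilt s t = true
  · have := orient_far s t n _ hs ht hO hl
    rw [he] at this
    simp [orient] at this
  · have := orient_far t s n _ ht hs hO (by rw [ilt_total s t h]; simpa using hl)
    rw [he] at this
    simp [orient] at this

/-- longest common prefix -/
def lcpB : List Bool → List Bool → List Bool
  | x :: a, y :: b => if x = y then x :: lcpB a b else []
  | _, _ => []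

lemma between_iff (a : List Bool) : ∀ b y, a.length = b.length → y.length < a.length →
    ((ilt a y = true ∧ ilt y b = true ∧ sg a b y = true) ↔ (ilt a b = true ∧ y = lcpB a b)) := by
  induction a with
  | nil => intro b y h1 h2; simp at h2
  | cons x a ih =>
    intro b y h1 h2
    rcases b with _ | ⟨z, b⟩
    · simp at h1
    · rcases y with _ | ⟨h, y⟩
      · cases x <;> cases z <;> simp [ilt, sg, lcpB]
      · have h1' : a.length = b.length := by simpa using h1
        have h2' : y.length < a.length := by simpa using h2
        have i1 := ih b y h1' h2'
        have n1 : a ≠ y := by rintro rfl; simp at h2'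
        have n2 : b ≠ y := by rintro rfl; omega
        have t1 := ilt_total a y n1
        have t2 := ilt_total b y n2
        cases x <;> cases z <;> cases h <;> simp_all [ilt, sg, lcpB]

/-- combinatorial containment in a triangle -/
def InS (a b c y : List Bool) : Prop := sg a b y = sg b c y ∧ sg b c y = sg c a y

lemma InS_rot (a b c y : List Bool) : InS a b c y ↔ InS b c a y := by
  unfold InS
  constructor
  · rintro ⟨h1, h2⟩; exact ⟨h2, by rw [← h2, h1]⟩
  · rintro ⟨h1, h2⟩; exact ⟨by rw [← h2, h1], h1⟩

lemma lcpB_comm (a : List Bool) : ∀ b, lcpB a b = lcpB b a := by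
  induction a with
  | nil => intro b; cases b <;> rfl
  | cons x a ih =>
    intro b
    cases b with
    | nil => rfl
    | cons y b =>
      by_cases h : x = y
      · subst h; simp [lcpB, ih b]
      · simp [lcpB, h, Ne.symm h]

lemma two_same (x z : Bool) (hxz : x ≠ z) (a b c y : List Bool) (hab : a ≠ b)
    (h1 : a.length = b.length) (h2 : c.length = a.length) (h3 : y.length < a.length + 1) :
    InS (x :: a) (x :: b) (z :: c) y ↔ y = x :: lcpB a b := by
  rcases y with _ | ⟨h, y⟩
  · simp only [InS, sg, ilt, if_neg hxz, if_neg hxz.symm]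
    cases x <;> cases z <;> simp_all
  · have h3' : y.length < a.length := by simpa using h3
    have n1 : a ≠ y := by rintro rfl; simp at h3'
    have n2 : b ≠ y := by rintro rfl; omega
    have n3 : c ≠ y := by rintro rfl; omega
    by_cases hx : h = x
    · subst hx
      have e : InS (h :: a) (h :: b) (z :: c) (h :: y) ↔
          (sg a b y = ilt y b ∧ ilt y b = ilt a y) := by
        simp [InS, sg, hxz, hxz.symm]
      rw [e]
      simp only [List.cons.injEq, true_and]
      have i1 := between_iff a b y h1 h3'
      have i2 := between_iff b a y h1.symm (by omega)
      rw [sg_anti a b y hab n1 n2, ilt_total a b hab, lcpB_comm b a] at i2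
      have t1 := ilt_total a y n1
      have t2 := ilt_total y b n2.symm
      rw [t1, t2] at i2
      revert i1 i2
      cases ilt a y <;> cases ilt y b <;> cases sg a b y <;> cases ilt a b <;> simp
    · have hz : h = z := by cases h <;> cases x <;> cases z <;> simp_all
      subst hz
      have t := ilt_total c y n3
      simp [InS, sg, hxz, hxz.symm, t]

lemma lcpB_length (a : List Bool) : ∀ b, a ≠ b → a.length = b.length →
    (lcpB a b).length < a.length := by
  induction a with
  | nil => intro b h1 h2; cases b <;> simp_all
  | cons x a ih =>
    intro b h1 h2
    cases b with
    | nil => simp at h2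
    | cons y b =>
      by_cases h : x = y
      · subst h
        simpa [lcpB] using ih b (by simpa using h1) (by simpa using h2)
      · simp [lcpB, h]

lemma exists_unique_InS (a : List Bool) : ∀ b c, a ≠ b → a ≠ c → b ≠ c →
    a.length = b.length → a.length = c.length →
    ∃ w, w ≠ [] ∧ w.length < a.length ∧ ∀ y, y.length < a.length → (InS a b c y ↔ y = w) := by
  induction a with
  | nil =>
    intro b c h1 h2 h3 h4 h5
    exact absurd (List.length_eq_zero_iff.1 h4.symm).symm h1
  | cons x a ih =>
    intro b c h1 h2 h3 h4 h5
    rcases b with _ | ⟨y, b⟩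
    · simp at h4
    rcases c with _ | ⟨z, c⟩
    · simp at h5
    have h4' : a.length = b.length := by simpa using h4
    have h5' : a.length = c.length := by simpa using h5
    by_cases hxy : x = y
    · subst hxy
      have h1' : a ≠ b := by simpa using h1
      by_cases hxz : x = z
      · subst hxz
        have h2' : a ≠ c := by simpa using h2
        have h3' : b ≠ c := by simpa using h3
        obtain ⟨w, hw1, hw2, hw3⟩ := ih b c h1' h2' h3' h4' h5'
        refine ⟨x :: w, by simp, by simpa using hw2, ?_⟩
        have nocyc : ¬ (ilt a b = ilt b c ∧ ilt b c = ilt c a) := by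
          rintro ⟨e1, e2⟩
          cases hb : ilt a b with
          | true =>
            have := ilt_trans a b c hb (by rw [← e1, hb])
            have t := ilt_total a c h2'
            rw [this, ← e2, ← e1, hb] at t
            simp at t
          | false =>
            have t1 := ilt_total a b h1'
            have t2 := ilt_total b c h3'
            have t3 := ilt_total c a h2'.symm
            rw [← e2, ← e1, hb] at t3
            rw [← e1, hb] at t2
            rw [hb] at t1
            have := ilt_trans c b a t2 t1
            rw [← e2, ← e1, hb] at this
            simp at this
        intro y hy
        rcases y with _ | ⟨h, y⟩
        · simp [InS, sg, ilt]
          simpa using nocyc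
        · by_cases hh : x = h
          · subst hh
            simpa [InS, sg] using hw3 y (by simpa using hy)
          · have e : InS (x :: a) (x :: b) (x :: c) (h :: y) ↔
              (ilt a b = ilt b c ∧ ilt b c = ilt c a) := by simp [InS, sg, hh]
            rw [e]
            simp only [nocyc, List.cons.injEq, Ne.symm hh, false_and]
      · refine ⟨x :: lcpB a b, by simp, by simpa using lcpB_length a b h1' h4', ?_⟩
        intro y hy
        exact two_same x z hxz a b c y h1' h4' h5'.symm (by simpa using hy)
    · by_cases hyz : y = z
      · subst hyz
        have h3' : b ≠ c := by simpa using h3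
        refine ⟨y :: lcpB b c, by simp, ?_, ?_⟩
        · have := lcpB_length b c h3' (by omega)
          simp only [List.length_cons]; omega
        · intro v hv
          rw [InS_rot]
          exact two_same y x (Ne.symm hxy) b c a v h3' (by omega) (by omega)
            (by simp only [List.length_cons] at hv; omega)
      · have : x = z := by cases x <;> cases y <;> cases z <;> simp_all
        subst this
        have h2' : c ≠ a := by simpa using h2.symm
        refine ⟨x :: lcpB c a, by simp, ?_, ?_⟩
        · have := lcpB_length c a h2' (by omega)
          simp only [List.length_cons]; omega
        · intro v hv
          rw [InS_rot, InS_rot]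
          exact two_same x y hxy c a b v h2' (by omega) (by omega)
            (by simp only [List.length_cons] at hv; omega)

lemma lcpB_append (w : List Bool) (m : ℕ) :
    lcpB (w ++ List.replicate (m + 1) false) (w ++ List.replicate (m + 1) true) = w := by
  induction w with
  | nil => simp [List.replicate_succ, lcpB]
  | cons x w ih => simp [lcpB, ih]

lemma exists_tri (w : List Bool) (hw : w ≠ []) (j : ℕ) (hj : w.length < j) :
    ∃ a b c : List Bool, a.length = j ∧ b.length = j ∧ c.length = j ∧ a ≠ b ∧ a ≠ c ∧ b ≠ c ∧
      InS a b c w := by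
  rcases w with _ | ⟨x, w⟩
  · simp at hw
  obtain ⟨m, rfl⟩ : ∃ m, j = w.length + 1 + (m + 1) := ⟨j - w.length - 2, by simp at hj; omega⟩
  have hne : w ++ List.replicate (m + 1) false ≠ w ++ List.replicate (m + 1) true := by
    simp [List.replicate_succ]
  refine ⟨x :: (w ++ List.replicate (m + 1) false), x :: (w ++ List.replicate (m + 1) true),
    (!x) :: (w ++ List.replicate (m + 1) false), by simp; omega, by simp; omega, by simp; omega,
    by simpa using hne, by simp, by simp, ?_⟩
  rw [two_same x (!x) (by simp) _ _ _ _ hne (by simp) (by simp) (by simp), lcpB_append]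

lemma sibling (s : List Bool) : ∀ y : List Bool, y.length ≤ s.length + 1 → y ≠ s ++ [false] →
    y ≠ s ++ [true] → sg (s ++ [false]) (s ++ [true]) y = true := by
  have hi : ∀ s : List Bool, ilt (s ++ [false]) (s ++ [true]) = true := by
    intro s
    induction s with
    | nil => rfl
    | cons x s ih => simpa [ilt] using ih
  induction s with
  | nil =>
    intro y h1 h2 h3
    rcases y with _ | ⟨h, y⟩
    · rfl
    · have : y = [] := by simpa using h1
      subst this
      cases h <;> simp_all
  | cons x s ih =>
    intro y h1 h2 h3
    rcases y with _ | ⟨h, y⟩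
    · simpa [sg, ilt] using hi s
    · by_cases hx : x = h
      · subst hx
        simpa [sg] using ih y (by simpa using h1) (by simpa using h2) (by simpa using h3)
      · simpa [sg, hx] using hi s

lemma hull_three (a b c : Pt) (p : Pt) : p ∈ convexHull ℝ ({a, b, c} : Set Pt) ↔
    ∃ u v w : ℝ, 0 ≤ u ∧ 0 ≤ v ∧ 0 ≤ w ∧ u + v + w = 1 ∧ u • a + v • b + w • c = p := by
  rw [convexHull_insert (by simp), convexHull_pair]
  simp only [mem_convexJoin, mem_singleton_iff, exists_eq_left]
  constructor
  · rintro ⟨q, ⟨s, t, hs, ht, hst, rfl⟩, u, v, hu, hv, huv, rfl⟩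
    refine ⟨u, v * s, v * t, hu, by positivity, by positivity, ?_, ?_⟩
    · rw [add_assoc, ← mul_add, hst]; linarith
    · simp [smul_smul, add_assoc]
  · rintro ⟨u, v, w, hu, hv, hw, h, rfl⟩
    rcases eq_or_lt_of_le (add_nonneg hv hw) with h0 | h0
    · refine ⟨b, left_mem_segment ℝ b c, u, 0, hu, le_rfl, by linarith, ?_⟩
      have : v = 0 := by linarith
      have : w = 0 := by linarith
      subst_vars; simp
    · refine ⟨(v / (v + w)) • b + (w / (v + w)) • c, ⟨v / (v + w), w / (v + w), by positivity,
        by positivity, by field_simp, rfl⟩, u, v + w, hu, h0.le, by linarith, ?_⟩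
      simp only [smul_add, smul_smul]
      rw [mul_div_cancel₀ _ h0.ne', mul_div_cancel₀ _ h0.ne', add_assoc]

lemma orient_sum (a b c p : Pt) :
    orient a b c = orient a b p + orient b c p + orient c a p := by
  simp only [orient]; ring

lemma tri_pos (a b c p : Pt) (h1 : 0 < orient a b p) (h2 : 0 < orient b c p)
    (h3 : 0 < orient c a p) : p ∈ interior (convexHull ℝ ({a, b, c} : Set Pt)) := by
  have hopen : IsOpen {p : Pt | 0 < orient a b p ∧ 0 < orient b c p ∧ 0 < orient c a p} := by
    unfold orient
    exact (isOpen_lt (by fun_prop) (by fun_prop)).and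
      ((isOpen_lt (by fun_prop) (by fun_prop)).and (isOpen_lt (by fun_prop) (by fun_prop)))
  refine interior_maximal ?_ hopen ⟨h1, h2, h3⟩
  rintro q ⟨g1, g2, g3⟩
  rw [hull_three]
  have hD := orient_sum a b c q
  have hpos : 0 < orient a b c := by linarith
  refine ⟨orient b c q / orient a b c, orient c a q / orient a b c, orient a b q / orient a b c,
    by positivity, by positivity, by positivity, ?_, ?_⟩
  · field_simp; linarith
  · ext
    · simp only [Prod.fst_add, Prod.smul_fst, smul_eq_mul]
      field_simp
      simp only [orient]; ring
    · simp only [Prod.snd_add, Prod.smul_snd, smul_eq_mul]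
      field_simp
      simp only [orient]; ring

lemma tri_nonneg (a b c p : Pt) (h : 0 < orient a b c)
    (hp : p ∈ convexHull ℝ ({a, b, c} : Set Pt)) :
    0 ≤ orient a b p ∧ 0 ≤ orient b c p ∧ 0 ≤ orient c a p := by
  rw [hull_three] at hp
  obtain ⟨u, v, w, hu, hv, hw, hs, rfl⟩ := hp
  have hu' : u = 1 - v - w := by linarith
  have e1 : orient a b (u • a + v • b + w • c) = w * orient a b c := by
    subst hu'
    simp only [orient, Prod.fst_add, Prod.smul_fst, smul_eq_mul, Prod.snd_add, Prod.smul_snd]; ring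
  have e2 : orient b c (u • a + v • b + w • c) = u * orient a b c := by
    subst hu'
    simp only [orient, Prod.fst_add, Prod.smul_fst, smul_eq_mul, Prod.snd_add, Prod.smul_snd]; ring
  have e3 : orient c a (u • a + v • b + w • c) = v * orient a b c := by
    subst hu'
    simp only [orient, Prod.fst_add, Prod.smul_fst, smul_eq_mul, Prod.snd_add, Prod.smul_snd]; ring
  rw [e1, e2, e3]
  exact ⟨by positivity, by positivity, by positivity⟩

/-- lexicographic support criterion for extreme points -/
lemma extreme_of_support (e : ℝ) (he : e ≠ 0) (S : Set Pt) (a b : Pt) (ha : a ∈ S) (hab : a ≠ b)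
    (h : ∀ y ∈ S, y ≠ a → y ≠ b → 0 < e * orient a b y) : a ∈ extremePts S := by
  set d : Pt → ℝ := fun y => (b.1 - a.1) * (y.1 - a.1) + (b.2 - a.2) * (y.2 - a.2) with hd
  set go : Pt → ℝ := fun y => e * orient a b y with hgo
  have hn : 0 < (b.1 - a.1) ^ 2 + (b.2 - a.2) ^ 2 := by
    by_contra hcon
    apply hab
    have e1 : b.1 - a.1 = 0 := by nlinarith [sq_nonneg (b.1 - a.1), sq_nonneg (b.2 - a.2)]
    have e2 : b.2 - a.2 = 0 := by nlinarith [sq_nonneg (b.1 - a.1), sq_nonneg (b.2 - a.2)]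
    ext <;> linarith
  have lin1 : ∀ (x y : Pt) (s t : ℝ), s + t = 1 →
      go (s • x + t • y) = s * go x + t * go y := by
    intro x y s t hst
    have : s = 1 - t := by linarith
    subst this
    simp only [hgo, orient, Prod.fst_add, Prod.smul_fst, smul_eq_mul, Prod.snd_add, Prod.smul_snd]; ring
  have lin2 : ∀ (x y : Pt) (s t : ℝ), s + t = 1 →
      d (s • x + t • y) = s * d x + t * d y := by
    intro x y s t hst
    have : s = 1 - t := by linarith
    subst this
    simp only [hd, Prod.fst_add, Prod.smul_fst, smul_eq_mul, Prod.snd_add, Prod.smul_snd]; ring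
  have hconv : Convex ℝ {p : Pt | 0 < go p ∨ (go p = 0 ∧ 0 ≤ d p)} := by
    intro x hx y hy s t hs ht hst
    simp only [mem_ofPred_eq] at hx hy ⊢
    rw [lin1 x y s t hst, lin2 x y s t hst]
    rcases eq_or_lt_of_le hs with rfl | hs
    · have : t = 1 := by linarith
      subst this; simpa using hy
    rcases eq_or_lt_of_le ht with rfl | ht
    · have : s = 1 := by linarith
      subst this; simpa using hx
    rcases hx with hx | ⟨hx, hx'⟩ <;> rcases hy with hy | ⟨hy, hy'⟩
    · left; positivity
    · left; rw [hy]; simpa using mul_pos hs hx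
    · left; rw [hx]; simpa using mul_pos ht hy
    · right; rw [hx, hy]; exact ⟨by simp, by positivity⟩
  have hsub : convexHull ℝ S ⊆ {p : Pt | 0 < go p ∨ (go p = 0 ∧ 0 ≤ d p)} := by
    refine convexHull_min ?_ hconv
    intro y hy
    by_cases h1 : y = a
    · subst h1; right; simp [hgo, orient, hd]
    · by_cases h2 : y = b
      · subst h2; right
        refine ⟨by simp only [hgo, orient]; ring, ?_⟩
        simp only [hd]; nlinarith
      · left; exact h y hy h1 h2
  have hzero : ∀ p : Pt, go p = 0 → d p = 0 → p = a := by
    intro p h1 h2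
    have h1 : orient a b p = 0 := (mul_eq_zero.1 h1).resolve_left he
    simp only [orient, hd] at h1 h2
    have e1 : ((b.1 - a.1) ^ 2 + (b.2 - a.2) ^ 2) * (p.1 - a.1) = 0 := by
      linear_combination (b.1 - a.1) * h2 - (b.2 - a.2) * h1
    have e2 : ((b.1 - a.1) ^ 2 + (b.2 - a.2) ^ 2) * (p.2 - a.2) = 0 := by
      linear_combination (b.2 - a.2) * h2 + (b.1 - a.1) * h1
    rw [mul_eq_zero] at e1 e2
    have e1 := e1.resolve_left hn.ne'
    have e2 := e2.resolve_left hn.ne'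
    ext <;> linarith
  refine mem_extremePoints.2 ⟨subset_convexHull ℝ S ha, ?_⟩
  rintro x hx y hy ⟨s, t, hs, ht, hst, hxy⟩
  have l1 := lin1 x y s t hst
  have l2 := lin2 x y s t hst
  rw [hxy] at l1 l2
  have z1 : go a = 0 := by simp [hgo, orient]
  have z2 : d a = 0 := by simp [hd]
  rw [z1] at l1
  rw [z2] at l2
  have p1 := hsub hx
  have p2 := hsub hy
  simp only [mem_ofPred_eq] at p1 p2
  have q1 : 0 ≤ go x := by rcases p1 with h | h <;> linarith [h]
  have q2 : 0 ≤ go y := by rcases p2 with h | h <;> linarith [h]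
  have r1 : go x = 0 := by nlinarith [mul_nonneg hs.le q1, mul_nonneg ht.le q2]
  have r2 : go y = 0 := by nlinarith [mul_nonneg hs.le q1, mul_nonneg ht.le q2]
  have d1 : 0 ≤ d x := by rcases p1 with h | h <;> linarith [h]
  have d2 : 0 ≤ d y := by rcases p2 with h | h <;> linarith [h]
  exact ⟨hzero x r1 (by nlinarith [mul_nonneg hs.le d1, mul_nonneg ht.le d2]),
    hzero y r2 (by nlinarith [mul_nonneg hs.le d1, mul_nonneg ht.le d2])⟩


section abstractPart

/-- a realization of the combinatorial order type -/
structure Realizes (k : ℕ) (f : List Bool → Pt) : Prop where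
  inj : ∀ s t : List Bool, s.length ≤ k → t.length ≤ k → s ≠ t → f s ≠ f t
  pos : ∀ s t r : List Bool, s.length ≤ k → t.length ≤ k → r.length ≤ k → s ≠ t → s ≠ r →
    t ≠ r → (0 < orient (f s) (f t) (f r) ↔ sg s t r = true)

/-- the union of the first `j` levels -/
def LL (f : List Bool → Pt) (j : ℕ) : Set Pt := f '' {s : List Bool | 1 ≤ s.length ∧ s.length ≤ j}

lemma Realizes.neg {k : ℕ} {f : List Bool → Pt} (hf : Realizes k f) (s t r : List Bool)
    (hs : s.length ≤ k) (ht : t.length ≤ k) (hr : r.length ≤ k) (h1 : s ≠ t) (h2 : s ≠ r)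
    (h3 : t ≠ r) (h : sg s t r = false) : orient (f s) (f t) (f r) < 0 := by
  have := (hf.pos t s r ht hs hr h1.symm h3 h2).2 (by rw [sg_anti s t r h1 h2 h3, h]; rfl)
  rw [orient_anti] at this
  linarith

lemma Realizes.ne_zero {k : ℕ} {f : List Bool → Pt} (hf : Realizes k f) (s t r : List Bool)
    (hs : s.length ≤ k) (ht : t.length ≤ k) (hr : r.length ≤ k) (h1 : s ≠ t) (h2 : s ≠ r)
    (h3 : t ≠ r) : orient (f s) (f t) (f r) ≠ 0 := by
  cases h : sg s t r with
  | true => exact ((hf.pos s t r hs ht hr h1 h2 h3).2 h).ne'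
  | false => exact (hf.neg s t r hs ht hr h1 h2 h3 h).ne

lemma Realizes.interior_of_InS {k : ℕ} {f : List Bool → Pt} (hf : Realizes k f)
    (a b c y : List Bool) (ha : a.length ≤ k) (hb : b.length ≤ k) (hc : c.length ≤ k)
    (hy : y.length ≤ k) (hab : a ≠ b) (hac : a ≠ c) (hbc : b ≠ c) (hay : a ≠ y) (hby : b ≠ y)
    (hcy : c ≠ y) (h : InS a b c y) :
    f y ∈ interior (convexHull ℝ ({f a, f b, f c} : Set Pt)) := by
  obtain ⟨h1, h2⟩ := h
  cases h3 : sg a b y with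
  | true =>
    rw [h3] at h1; rw [← h1] at h2
    exact tri_pos _ _ _ _ ((hf.pos a b y ha hb hy hab hay hby).2 h3)
      ((hf.pos b c y hb hc hy hbc hby hcy).2 h1.symm)
      ((hf.pos c a y hc ha hy hac.symm hcy hay).2 h2.symm)
  | false =>
    rw [h3] at h1; rw [← h1] at h2
    have g1 := hf.neg a b y ha hb hy hab hay hby h3
    have g2 := hf.neg b c y hb hc hy hbc hby hcy h1.symm
    have g3 := hf.neg c a y hc ha hy hac.symm hcy hay h2.symm
    rw [insert_comm]
    refine tri_pos _ _ _ _ ?_ ?_ ?_ <;> rw [orient_anti] <;> linarith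

lemma Realizes.InS_of_hull {k : ℕ} {f : List Bool → Pt} (hf : Realizes k f)
    (a b c y : List Bool) (ha : a.length ≤ k) (hb : b.length ≤ k) (hc : c.length ≤ k)
    (hy : y.length ≤ k) (hab : a ≠ b) (hac : a ≠ c) (hbc : b ≠ c) (hay : a ≠ y) (hby : b ≠ y)
    (hcy : c ≠ y) (h : f y ∈ convexHull ℝ ({f a, f b, f c} : Set Pt)) : InS a b c y := by
  have n1 := hf.ne_zero a b y ha hb hy hab hay hby
  have n2 := hf.ne_zero b c y hb hc hy hbc hby hcy
  have n3 := hf.ne_zero c a y hc ha hy hac.symm hcy hay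
  rcases lt_or_gt_of_ne (hf.ne_zero a b c ha hb hc hab hac hbc) with hlt | hgt
  · rw [insert_comm] at h
    obtain ⟨g1, g2, g3⟩ := tri_nonneg _ _ _ _ (by rw [orient_anti]; linarith) h
    rw [orient_anti] at g1 g2 g3
    have e1 : ¬ sg a b y = true := by
      rw [← hf.pos a b y ha hb hy hab hay hby]; linarith
    have e2 : ¬ sg b c y = true := by
      rw [← hf.pos b c y hb hc hy hbc hby hcy]; linarith
    have e3 : ¬ sg c a y = true := by
      rw [← hf.pos c a y hc ha hy hac.symm hcy hay]; linarith
    simp only [Bool.not_eq_true] at e1 e2 e3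
    simp [InS, e1, e2, e3]
  · obtain ⟨g1, g2, g3⟩ := tri_nonneg _ _ _ _ hgt h
    have e1 := (hf.pos a b y ha hb hy hab hay hby).1 (lt_of_le_of_ne g1 n1.symm)
    have e2 := (hf.pos b c y hb hc hy hbc hby hcy).1 (lt_of_le_of_ne g2 n2.symm)
    have e3 := (hf.pos c a y hc ha hy hac.symm hcy hay).1 (lt_of_le_of_ne g3 n3.symm)
    simp [InS, e1, e2, e3]

lemma ne_of_len {s t : List Bool} (h : t.length < s.length) : s ≠ t := by
  rintro rfl; omega

lemma Realizes.extreme {k : ℕ} {f : List Bool → Pt} (hf : Realizes k f) (j : ℕ)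
    (hj : 1 ≤ j) (hjk : j ≤ k) : extremePts (LL f j) = f '' {s : List Bool | s.length = j} := by
  apply Subset.antisymm
  · intro p hp
    obtain ⟨w, ⟨hw1, hw2⟩, rfl⟩ := extremePoints_convexHull_subset hp
    rcases eq_or_lt_of_le hw2 with he | hlt
    · exact ⟨w, he, rfl⟩
    · exfalso
      obtain ⟨a, b, c, ha, hb, hc, hab, hac, hbc, hin⟩ :=
        exists_tri w (by rintro rfl; simp at hw1) j hlt
      have hi := interior_subset (hf.interior_of_InS a b c w (by omega) (by omega) (by omega)
        (by omega) hab hac hbc (ne_of_len (by omega)) (ne_of_len (by omega))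
        (ne_of_len (by omega)) hin)
      have := ((convex_convexHull ℝ (LL f j)).mem_extremePoints_iff_mem_sdiff_convexHull_sdiff).1 hp
      apply this.2
      refine convexHull_mono ?_ hi
      have key : ∀ v : List Bool, v.length = j → f v ∈ convexHull ℝ (LL f j) \ {f w} := by
        intro v hv
        refine ⟨subset_convexHull ℝ _ ⟨v, ⟨by omega, by omega⟩, rfl⟩, ?_⟩
        exact hf.inj v w (by omega) (by omega) (ne_of_len (by omega))
      rintro q (rfl | rfl | rfl)
      · exact key a ha
      · exact key b hb
      · exact key c hc
  · rintro p ⟨s, hs, rfl⟩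
    have hs : s.length = j := hs
    have hne : s ≠ [] := by rintro rfl; simp only [List.length_nil] at hs; omega
    obtain ⟨v, x, rfl⟩ : ∃ v x, s = v ++ [x] := ⟨s.dropLast, s.getLast hne, (List.dropLast_append_getLast hne).symm⟩
    have hv : v.length + 1 = j := by simpa using hs
    cases x with
    | false =>
      refine extreme_of_support 1 one_ne_zero _ _ (f (v ++ [true])) ⟨_, ⟨by omega, by omega⟩, rfl⟩
        (hf.inj _ _ (by omega) (by simp; omega) (by simp)) ?_
      rintro y ⟨t, ⟨ht1, ht2⟩, rfl⟩ h1 h2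
      have n1 : t ≠ v ++ [false] := fun h => h1 (by rw [h])
      have n2 : t ≠ v ++ [true] := fun h => h2 (by rw [h])
      rw [one_mul]
      exact (hf.pos _ _ _ (by omega) (by simp; omega) (by omega) (by simp) n1.symm n2.symm).2
        (sibling v t (by omega) n1 n2)
    | true =>
      refine extreme_of_support (-1) (by norm_num) _ _ (f (v ++ [false])) ⟨_, ⟨by omega, by omega⟩, rfl⟩
        (hf.inj _ _ (by omega) (by simp; omega) (by simp)) ?_
      rintro y ⟨t, ⟨ht1, ht2⟩, rfl⟩ h1 h2
      have n1 : t ≠ v ++ [true] := fun h => h1 (by rw [h])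
      have n2 : t ≠ v ++ [false] := fun h => h2 (by rw [h])
      rw [orient_anti]
      have := (hf.pos _ _ _ (by simp; omega) (by omega) (by omega) (by simp) n2.symm n1.symm).2
        (sibling v t (by omega) n2 n1)
      linarith

lemma Realizes.peel_LL {k : ℕ} {f : List Bool → Pt} (hf : Realizes k f) (j : ℕ)
    (hjk : j + 1 ≤ k) : peel (LL f (j + 1)) = LL f j := by
  unfold peel
  rw [hf.extreme (j + 1) (by omega) hjk]
  ext p
  constructor
  · rintro ⟨⟨s, ⟨h1, h2⟩, rfl⟩, h3⟩
    refine ⟨s, ⟨h1, ?_⟩, rfl⟩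
    by_contra hc
    exact h3 ⟨s, by simp only [mem_ofPred_eq]; omega, rfl⟩
  · rintro ⟨s, ⟨h1, h2⟩, rfl⟩
    refine ⟨⟨s, ⟨h1, by omega⟩, rfl⟩, ?_⟩
    rintro ⟨t, ht, he⟩
    have ht : t.length = j + 1 := ht
    exact hf.inj t s (by omega) (by omega) (ne_of_len (by omega)) he

lemma Realizes.peel_iter {k : ℕ} {f : List Bool → Pt} (hf : Realizes k f) (i : ℕ)
    (hi : i ≤ k) : peel^[i] (LL f k) = LL f (k - i) := by
  induction i with
  | zero => simp
  | succ i ih =>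
    rw [Function.iterate_succ_apply', ih (by omega)]
    have : k - i = (k - (i + 1)) + 1 := by omega
    rw [this, hf.peel_LL _ (by omega)]

lemma LL_nonempty (f : List Bool → Pt) (j : ℕ) (hj : 1 ≤ j) : (LL f j).Nonempty :=
  ⟨f [true], [true], ⟨by simp, by simpa using hj⟩, rfl⟩

lemma LL_zero (f : List Bool → Pt) : LL f 0 = ∅ := by
  ext p
  simp only [LL, mem_image, mem_ofPred_eq, mem_empty_iff_false, iff_false]
  rintro ⟨s, ⟨h1, h2⟩, -⟩
  omega

lemma strings_finite (k : ℕ) : {s : List Bool | 1 ≤ s.length ∧ s.length ≤ k}.Finite :=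
  (List.finite_length_le Bool k).subset fun _ hs => hs.2

lemma Realizes.isNACS {k : ℕ} {f : List Bool → Pt} (hf : Realizes k f) (hk : 1 ≤ k) :
    IsNACS (LL f k) := by
  refine ⟨(strings_finite k).image f, LL_nonempty f k hk, ?_, ?_⟩
  · rintro _ ⟨s, ⟨-, hs⟩, rfl⟩ _ ⟨t, ⟨-, ht⟩, rfl⟩ _ ⟨r, ⟨-, hr⟩, rfl⟩ h1 h2 h3
    exact hf.ne_zero s t r hs ht hr (fun h => h1 (by rw [h])) (fun h => h2 (by rw [h]))
      (fun h => h3 (by rw [h]))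
  · intro k' hk' j hj1 hj2
    have : k' = k := by
      rcases lt_trichotomy k' k with h | h | h
      · have e := hk'.1
        rw [hf.peel_iter k' h.le] at e
        exact absurd e (LL_nonempty f _ (by omega)).ne_empty
      · exact h
      · have e := hk'.2 k h
        rw [hf.peel_iter k le_rfl, Nat.sub_self, LL_zero] at e
        exact absurd rfl e
    subst this
    have e1 : layer (LL f k') k' j = f '' {s : List Bool | s.length = j} := by
      unfold layer layerSub
      rw [hf.peel_iter _ (by omega), show k' - (k' - j) = j by omega, hf.extreme j hj1 hj2]
    have e2 : layerSub (LL f k') k' (j - 1) = LL f (j - 1) := by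
      unfold layerSub
      rw [hf.peel_iter _ (by omega), show k' - (k' - (j - 1)) = j - 1 by omega]
    rw [e1, e2]
    rintro _ ⟨a, ha, rfl⟩ _ ⟨b, hb, rfl⟩ _ ⟨c, hc, rfl⟩ h1 h2 h3
    have ha : a.length = j := ha
    have hb : b.length = j := hb
    have hc : c.length = j := hc
    have hab : a ≠ b := fun h => h1 (by rw [h])
    have hac : a ≠ c := fun h => h2 (by rw [h])
    have hbc : b ≠ c := fun h => h3 (by rw [h])
    obtain ⟨w, hw1, hw2, hw3⟩ := exists_unique_InS a b c hab hac hbc (by omega) (by omega)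
    have hw0 : 1 ≤ w.length := List.length_pos_iff.2 hw1
    refine ⟨f w, ⟨⟨w, ⟨hw0, by omega⟩, rfl⟩, ?_⟩, ?_⟩
    · exact hf.interior_of_InS a b c w (by omega) (by omega) (by omega) (by omega) hab hac hbc
        (ne_of_len (by omega)) (ne_of_len (by omega)) (ne_of_len (by omega))
        ((hw3 w hw2).2 rfl)
    · rintro _ ⟨⟨y, ⟨hy1, hy2⟩, rfl⟩, hy3⟩
      have hin := hf.InS_of_hull a b c y (by omega) (by omega) (by omega) (by omega) hab hac hbc
        (ne_of_len (by omega)) (ne_of_len (by omega)) (ne_of_len (by omega))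
        (interior_subset hy3)
      rw [(hw3 y (by omega)).1 hin]

end abstractPart

/-- the point with local coordinates `P` in the frame `α` -/
def framePt (α : Pt × Pt × Pt) (P : Pt) : Pt :=
  α.2.1 + P.1 • (α.2.2 - α.2.1) + P.2 • (α.1 - α.2.1)

lemma framePt_step (α : Pt × Pt × Pt) (b : Bool) (P : Pt) :
    framePt (cornerStep α b) P = framePt α (AA b P) := by
  cases b <;> simp only [framePt, cornerStep, AA] <;>
    simp only [Bool.false_eq_true, if_false, if_true] <;> ext <;> simp <;> ring

lemma framePt_foldl (s : List Bool) : ∀ (α : Pt × Pt × Pt) (P : Pt),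
    framePt (s.foldl cornerStep α) P = framePt α (s.foldr AA P) := by
  induction s with
  | nil => intro α P; rfl
  | cons b s ih => intro α P; simp only [List.foldl_cons, List.foldr_cons, ih, framePt_step]

lemma framePt_root (k : ℕ) (P : Pt) : framePt (corner k []) P = (2 * 5 ^ (k + 1) : ℝ) • P := by
  ext <;> simp [framePt, corner] <;> ring

lemma ypt_append (k : ℕ) (v : List Bool) (b : Bool) :
    ypt k (v ++ [b]) = (2 * 5 ^ (k + 1) : ℝ) •
      v.foldr AA (if b then (1 / 5, 0) else (0, 1 / 5)) := by
  rw [← framePt_root, corner, List.foldl_nil, ← framePt_foldl]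
  cases b <;> simp [ypt, framePt, corner]

lemma foldr_rep (m : ℕ) (b : Bool) :
    (List.replicate m b).foldr AA (if b then (1 / 5, 0) else (0, 1 / 5)) =
      if b then (2 * cc (m + 1), 0) else (0, 2 * cc (m + 1)) := by
  induction m with
  | zero => cases b <;> simp [cc] <;> norm_num
  | succ m ih =>
    rw [List.replicate_succ, List.foldr_cons, ih, show cc (m + 1 + 1) = (1 + 2 * cc (m + 1)) / 10 from rfl]
    cases b <;> simp [AA] <;> ring

lemma AA_mid (b : Bool) (P Q : Pt) :
    (1 / 2 : ℝ) • (AA b P + AA b Q) = AA b ((1 / 2 : ℝ) • (P + Q)) := by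
  cases b <;> simp only [AA] <;> simp only [Bool.false_eq_true, if_false, if_true] <;>
    ext <;> simp <;> ring

lemma foldr_mid (s : List Bool) (P Q : Pt) :
    (1 / 2 : ℝ) • (s.foldr AA P + s.foldr AA Q) = s.foldr AA ((1 / 2 : ℝ) • (P + Q)) := by
  induction s with
  | nil => rfl
  | cons b s ih => simp only [List.foldr_cons, AA_mid, ih]

lemma zz_foldr (s : List Bool) (n : ℕ) :
    zz (s.length + n) s = s.foldr AA (cc n, cc n) := by
  induction s with
  | nil => simp [zz]
  | cons b s ih =>
    rw [List.length_cons, show s.length + 1 + n = (s.length + n) + 1 by omega, zz, ih]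
    rfl

lemma xpt_eq (k : ℕ) (s : List Bool) (hs : s.length ≤ k) :
    xpt k s = (2 * 5 ^ (k + 1) : ℝ) • zz (k + 1) s := by
  obtain ⟨m, rfl⟩ := Nat.exists_eq_add_of_le hs
  have e : s.length + m + 1 - s.length = m + 1 := by omega
  unfold xpt
  rw [e, List.replicate_succ', List.replicate_succ', ← List.append_assoc, ← List.append_assoc,
    ypt_append, ypt_append, List.foldr_append, List.foldr_append, foldr_rep, foldr_rep,
    ← smul_add, smul_comm, foldr_mid, add_assoc s.length m 1, zz_foldr]
  congr 2
  ext <;> simp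

lemma xpt_realizes (k : ℕ) : Realizes k (xpt k) := by
  have hN : (0 : ℝ) < 2 * 5 ^ (k + 1) := by positivity
  constructor
  · intro s t hs ht hst h
    rw [xpt_eq k s hs, xpt_eq k t ht] at h
    exact zz_inj s t (k + 1) (by omega) (by omega) hst (smul_right_injective _ hN.ne' h)
  · intro s t r hs ht hr h1 h2 h3
    rw [xpt_eq k s hs, xpt_eq k t ht, xpt_eq k r hr,
      ← orient_sg_iff s t r (k + 1) (by omega) (by omega) (by omega) h1 h2 h3]
    have : ∀ (N : ℝ) (p q r : Pt), orient (N • p) (N • q) (N • r) = N ^ 2 * orient p q r := by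
      intro N p q r
      simp only [orient, Prod.smul_fst, Prod.smul_snd, smul_eq_mul]; ring
    rw [this]
    exact mul_pos_iff_of_pos_left (by positivity)

lemma cc_int (n : ℕ) : ∃ a : ℤ, (2 * 5 ^ n : ℝ) * cc n = a := by
  induction n with
  | zero => exact ⟨0, by simp [cc]⟩
  | succ n ih =>
    obtain ⟨a, ha⟩ := ih
    refine ⟨5 ^ n + a, ?_⟩
    push_cast
    rw [← ha, cc]; ring

lemma zz_int (s : List Bool) : ∀ n, s.length < n → ∃ a b : ℤ,
    (2 * 5 ^ n : ℝ) * (zz n s).1 = a ∧ (2 * 5 ^ n : ℝ) * (zz n s).2 = b := by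
  induction s with
  | nil =>
    intro n hn
    obtain ⟨a, ha⟩ := cc_int n
    exact ⟨a, a, by simpa [zz] using ha, by simpa [zz] using ha⟩
  | cons c s ih =>
    intro n hn
    obtain ⟨m, rfl⟩ : ∃ m, n = m + 1 := ⟨n - 1, by simp at hn; omega⟩
    obtain ⟨a, b, ha, hb⟩ := ih m (by simpa using hn)
    cases c with
    | false =>
      refine ⟨a, 2 * 5 ^ m + b - a, ?_, ?_⟩
      · rw [← ha]; simp [zz, AA]; ring
      · push_cast; rw [← ha, ← hb]; simp [zz, AA]; ring
    | true =>
      refine ⟨2 * 5 ^ m - b + a, b, ?_, ?_⟩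
      · push_cast; rw [← ha, ← hb]; simp [zz, AA]; ring
      · rw [← hb]; simp [zz, AA]; ring

lemma strings_card (k : ℕ) :
    {s : List Bool | 1 ≤ s.length ∧ s.length ≤ k}.ncard = 2 ^ (k + 1) - 2 := by
  induction k with
  | zero =>
    have : {s : List Bool | 1 ≤ s.length ∧ s.length ≤ 0} = ∅ := by
      ext s; simp only [mem_ofPred_eq, mem_empty_iff_false, iff_false]; omega
    rw [this]; simp
  | succ k ih =>
    have e : {s : List Bool | 1 ≤ s.length ∧ s.length ≤ k + 1} =
        {s : List Bool | 1 ≤ s.length ∧ s.length ≤ k} ∪ {s : List Bool | s.length = k + 1} := by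
      ext s; simp only [mem_ofPred_eq, mem_union]; omega
    have hc : {s : List Bool | s.length = k + 1}.ncard = 2 ^ (k + 1) := by
      have := card_vector (α := Bool) (k + 1)
      rw [Fintype.card_bool] at this
      rw [← this, ← Nat.card_coe_set_eq, ← Nat.card_eq_fintype_card]
      rfl
    rw [e, ncard_union_eq ?_ (strings_finite k) (List.finite_length_eq Bool (k + 1)), ih, hc]
    · have : 2 ≤ 2 ^ (k + 1) := by rw [pow_succ]; have := Nat.one_le_two_pow (n := k); omega
      rw [pow_succ 2 (k + 1)]; omega
    · rw [disjoint_left]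
      intro s h1 h2
      simp only [mem_ofPred_eq] at h1 h2
      omega

/-- In the corner construction, the midpoints `x_s` (over binary strings `s`
with `1 ≤ |s| ≤ k`) are pairwise distinct, have integer coordinates of absolute value at most
`2·5^(k+1)`, and form a nested almost convex set with `2^(k+1) − 2` points. -/
theorem xpt_is_nacs (k : ℕ) (hk : 1 ≤ k) :
    (∀ s t : List Bool, 1 ≤ s.length → s.length ≤ k → 1 ≤ t.length → t.length ≤ k →
      s ≠ t → xpt k s ≠ xpt k t) ∧
    (∀ s : List Bool, 1 ≤ s.length → s.length ≤ k →
      ∃ a b : ℤ, xpt k s = ((a : ℝ), (b : ℝ)) ∧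
        |a| ≤ 2 * 5 ^ (k + 1) ∧ |b| ≤ 2 * 5 ^ (k + 1)) ∧
    IsNACS (xpt k '' {s : List Bool | 1 ≤ s.length ∧ s.length ≤ k}) ∧
    (xpt k '' {s : List Bool | 1 ≤ s.length ∧ s.length ≤ k}).ncard = 2 ^ (k + 1) - 2 := by
  have hR := xpt_realizes k
  refine ⟨fun s t _ hs _ ht hst => hR.inj s t hs ht hst, ?_, hR.isNACS hk, ?_⟩
  · intro s _ hs
    obtain ⟨a, b, ha, hb⟩ := zz_int s (k + 1) (by omega)
    obtain ⟨h1, h2, h3, h4, h5, h6⟩ := zz_T s (k + 1) (by omega)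
    have hc := cc_le (k + 1)
    have hN : (0 : ℝ) < 2 * 5 ^ (k + 1) := by positivity
    refine ⟨a, b, ?_, ?_, ?_⟩
    · rw [xpt_eq k s hs, ← ha, ← hb]; rfl
    · have g1 : (0 : ℝ) ≤ a := by rw [← ha]; positivity
      have g2 : (a : ℝ) ≤ 2 * 5 ^ (k + 1) := by rw [← ha]; nlinarith
      rw [abs_of_nonneg (by exact_mod_cast g1)]
      exact_mod_cast g2
    · have g1 : (0 : ℝ) ≤ b := by rw [← hb]; positivity
      have g2 : (b : ℝ) ≤ 2 * 5 ^ (k + 1) := by rw [← hb]; nlinarith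
      rw [abs_of_nonneg (by exact_mod_cast g1)]
      exact_mod_cast g2
  · rw [ncard_image_of_injOn, strings_card]
    intro s hs t ht h
    by_contra hne
    exact hR.inj s t hs.2 ht.2 hne h
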